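/- Let n ≥ 2 and let w̃ be a fully commutative element of the Coxeter group of type C̃_n. For any reduced expression s̃_{i_1}⋯s̃_{i_k} of w̃, there exist a unique natural number α(w̃) and a unique fully commutative element τ(w̃) of the Coxeter group of type A_{n+1} such that in the Temperley–Lieb algebra TL(A_{n+1}) one has b_{i_1}⋯b_{i_k} = δ^{α(w̃)} · b_{τ(w̃)}; moreover α(w̃) and τ(w̃) do not depend on the chosen reduced expression of w̃. -/

import Mathlib

namespace BCF
open List

/-! ### Coxeter matrices of types `A_{n+1}` and `C̃_n`.

Generators are indexed by `Fin (n+1)`, with index `i` corresponding to the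
generator `s_{i+1}` (resp. `s̃_{i+1}`) of the paper. -/

/-- Entries of the Coxeter matrix of affine type `C̃ₙ` (on indices `0, …, n`). -/
def cval (n a b : ℕ) : ℕ :=
  if a = b then 1
  else if max a b = min a b + 1 then (if min a b = 0 ∨ max a b = n then 4 else 3)
  else 2

/-- Entries of the Coxeter matrix of type `A_{n+1}` (on indices `0, …, n`). -/
def aval (a b : ℕ) : ℕ :=
  if a = b then 1 else if max a b = min a b + 1 then 3 else 2

lemma cval_symm (n a b : ℕ) : cval n a b = cval n b a := by
  unfold cval
  rcases eq_or_ne a b with h | h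
  · simp [h]
  · rw [if_neg h, if_neg (Ne.symm h), Nat.max_comm b a, Nat.min_comm b a]

lemma aval_symm (a b : ℕ) : aval a b = aval b a := by
  unfold aval
  rcases eq_or_ne a b with h | h
  · simp [h]
  · rw [if_neg h, if_neg (Ne.symm h), Nat.max_comm b a, Nat.min_comm b a]

lemma cval_ne_one (n a b : ℕ) (h : a ≠ b) : cval n a b ≠ 1 := by
  unfold cval
  rw [if_neg h]
  split <;> [skip; omega]
  split <;> omega

lemma aval_ne_one (a b : ℕ) (h : a ≠ b) : aval a b ≠ 1 := by
  unfold aval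
  rw [if_neg h]
  split <;> omega

/-- The Coxeter matrix of type `C̃ₙ` on the generator set `{s̃₁, …, s̃ₙ₊₁}`. -/
def CMat (n : ℕ) : CoxeterMatrix (Fin (n + 1)) where
  M := Matrix.of fun i j => cval n i.val j.val
  isSymm := by
    unfold Matrix.IsSymm
    ext i j
    exact cval_symm n j i
  diagonal i := by simp [cval]
  off_diagonal i j h := cval_ne_one n i j (fun hc => h (Fin.ext hc))

/-- The Coxeter matrix of type `A_{n+1}` on the generator set `{s₁, …, sₙ₊₁}`. -/
def AMat (n : ℕ) : CoxeterMatrix (Fin (n + 1)) where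
  M := Matrix.of fun i j => aval i.val j.val
  isSymm := by
    unfold Matrix.IsSymm
    ext i j
    exact aval_symm j i
  diagonal i := by simp [aval]
  off_diagonal i j h := aval_ne_one i j (fun hc => h (Fin.ext hc))

/-- The Coxeter group of type `C̃ₙ`. -/
abbrev WC (n : ℕ) : Type := (CMat n).Group

/-- The Coxeter group of type `A_{n+1}`. -/
abbrev WA (n : ℕ) : Type := (AMat n).Group

/-- The Coxeter system of type `C̃ₙ`. -/
def csC (n : ℕ) : CoxeterSystem (CMat n) (WC n) := (CMat n).toCoxeterSystem

/-- The Coxeter system of type `A_{n+1}`. -/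
def csA (n : ℕ) : CoxeterSystem (AMat n) (WA n) := (AMat n).toCoxeterSystem

/-! ### Commutation moves and fully commutative elements -/

/-- One commutation move: swap two adjacent commuting letters. -/
def CommMove {B : Type*} (Mx : CoxeterMatrix B) (l l' : List B) : Prop :=
  ∃ (u v : List B) (i j : B), Mx.M i j = 2 ∧ l = u ++ i :: j :: v ∧ l' = u ++ j :: i :: v

/-- Two words are in the same commutation class. -/
def CommEquiv {B : Type*} (Mx : CoxeterMatrix B) : List B → List B → Prop :=
  Relation.ReflTransGen (CommMove Mx)

/-- An element of a Coxeter group is *fully commutative* (FC) if any reduced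
expression for it can be obtained from any other by commutation moves only. -/
def IsFC {B : Type*} {W : Type*} [Group W] {Mx : CoxeterMatrix B}
    (cs : CoxeterSystem Mx W) (w : W) : Prop :=
  ∀ l l' : List B, cs.IsReduced l → cs.wordProd l = w →
    cs.IsReduced l' → cs.wordProd l' = w → CommEquiv Mx l l'

/-! ### The Temperley–Lieb algebra of type `A_{n+1}` -/

noncomputable section

/-- The defining relations of the Temperley–Lieb algebra `TL(A_{n+1})`
over `ℤ[δ]`: (a1) `bᵢ² = δ bᵢ`; (a2) `bᵢbⱼ = bⱼbᵢ` for `|i-j| > 1`;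
(a3) `bᵢbⱼbᵢ = bᵢ` for `|i-j| = 1`. -/
inductive TLRel (n : ℕ) :
    FreeAlgebra (Polynomial ℤ) (Fin (n + 1)) → FreeAlgebra (Polynomial ℤ) (Fin (n + 1)) → Prop
  | sq (i : Fin (n + 1)) :
      TLRel n (FreeAlgebra.ι (Polynomial ℤ) i * FreeAlgebra.ι (Polynomial ℤ) i)
        ((Polynomial.X : Polynomial ℤ) • FreeAlgebra.ι (Polynomial ℤ) i)
  | comm (i j : Fin (n + 1)) (h : aval i.val j.val = 2) :
      TLRel n (FreeAlgebra.ι (Polynomial ℤ) i * FreeAlgebra.ι (Polynomial ℤ) j)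
        (FreeAlgebra.ι (Polynomial ℤ) j * FreeAlgebra.ι (Polynomial ℤ) i)
  | braid (i j : Fin (n + 1)) (h : aval i.val j.val = 3) :
      TLRel n (FreeAlgebra.ι (Polynomial ℤ) i * FreeAlgebra.ι (Polynomial ℤ) j *
          FreeAlgebra.ι (Polynomial ℤ) i)
        (FreeAlgebra.ι (Polynomial ℤ) i)

/-- The Temperley–Lieb algebra `TL(A_{n+1})` as a quotient of the free
`ℤ[δ]`-algebra on the generators `b₁, …, b_{n+1}`. -/
abbrev TLA (n : ℕ) : Type := RingQuot (TLRel n)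

/-- The generator `b_{i+1}` of `TL(A_{n+1})`. -/
def tlGen (n : ℕ) (i : Fin (n + 1)) : TLA n :=
  RingQuot.mkAlgHom (Polynomial ℤ) (TLRel n) (FreeAlgebra.ι (Polynomial ℤ) i)

/-- The product `b_{i₁} ⋯ b_{i_k}` in `TL(A_{n+1})` associated with a word. -/
def bProd (n : ℕ) (l : List (Fin (n + 1))) : TLA n := (l.map (tlGen n)).prod

/-- The element `δ` of `TL(A_{n+1})`. -/
def tlδ (n : ℕ) : TLA n := algebraMap (Polynomial ℤ) (TLA n) Polynomial.X

end

end BCF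
namespace BCF
open Equiv

def sw (i : ℕ) : Perm ℕ := swap i (i+1)

lemma sw_apply (i x : ℕ) : sw i x = if x = i then i+1 else if x = i+1 then i else x := by
  unfold sw; rw [swap_apply_def]

lemma sw_sq (i : ℕ) : sw i * sw i = 1 := by simp [sw]

lemma sw_comm (i j : ℕ) (h : i + 1 < j) : sw i * sw j = sw j * sw i := by
  ext x; simp only [Perm.mul_apply, sw_apply]; grind

lemma sw_braid (i : ℕ) : sw i * sw (i+1) * sw i = sw (i+1) * sw i * sw (i+1) := by
  ext x; simp only [Perm.mul_apply, sw_apply]; grind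

lemma pow3_of_braid {G : Type*} [Group G] {a b : G} (ha : a * a = 1) (hb : b * b = 1)
    (h : a * b * a = b * a * b) : (a * b)^3 = 1 := by
  have : (a*b)^3 = (a * b * a) * (b * a * b) := by simp only [pow_succ, pow_zero, one_mul, mul_assoc]
  rw [this, ← h]
  calc a * b * a * (a * b * a) = a * b * (a * a) * b * a := by group
    _ = a * (b * b) * a := by rw [ha]; group
    _ = 1 := by rw [hb]; simpa using ha

lemma braid_of_pow3 {G : Type*} [Group G] {a b : G} (ha : a * a = 1) (hb : b * b = 1)
    (h : (a * b)^3 = 1) : a * b * a = b * a * b := by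
  have h1 : (a * b * a) * (b * a * b) = 1 := by rw [← h]; simp only [pow_succ, pow_zero, one_mul, mul_assoc]
  have h2 : (b * a * b) * (b * a * b) = 1 := by
    calc (b * a * b) * (b * a * b) = b * a * (b * b) * a * b := by group
     _ = b * (a * a) * b := by rw [hb]; group
     _ = 1 := by rw [ha]; simpa using hb
  exact mul_right_cancel (h1.trans h2.symm)

lemma aval_two {a b : ℕ} : aval a b = 2 ↔ (a + 1 < b ∨ b + 1 < a) := by
  unfold aval; split_ifs <;> omega
lemma aval_three {a b : ℕ} : aval a b = 3 ↔ (a + 1 = b ∨ b + 1 = a) := by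
  unfold aval; split_ifs <;> omega

lemma AMat_apply (n : ℕ) (i j : Fin (n+1)) : (AMat n).M i j = aval i j := rfl
lemma AMat_apply' (n : ℕ) (i j : Fin (n+1)) : (AMat n) i j = aval i j := rfl

lemma liftable (n : ℕ) : (AMat n).IsLiftable (fun i : Fin (n+1) => sw i.val) := by
  intro i j
  rw [AMat_apply']
  by_cases h : i = j
  · subst h; simp [aval, sw_sq]
  have hne : i.val ≠ j.val := fun hc => h (Fin.ext hc)
  by_cases h3 : aval i.val j.val = 3
  · rw [h3]
    apply pow3_of_braid (sw_sq _) (sw_sq _)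
    rcases aval_three.1 h3 with h | h
    · rw [← h]; exact sw_braid _
    · rw [← h]; exact (sw_braid _).symm
  · have h2 : aval i.val j.val = 2 := by
      unfold aval at *; split_ifs at * <;> simp_all
    have hc : sw i.val * sw j.val = sw j.val * sw i.val := by
      rcases aval_two.1 h2 with h | h
      · exact sw_comm _ _ h
      · exact (sw_comm _ _ h).symm
    rw [h2, pow_two]; nth_rewrite 2 [hc]
    rw [mul_assoc, ← mul_assoc (sw j.val), sw_sq, one_mul, sw_sq]

def pf (n : ℕ) : WA n →* Perm ℕ := (csA n).lift ⟨_, liftable n⟩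

lemma pf_simple (n : ℕ) (i : Fin (n+1)) : pf n ((csA n).simple i) = sw i.val :=
  (csA n).lift_apply_simple (liftable n) i

lemma A_comm {n : ℕ} {i j : Fin (n+1)} (h : aval i.val j.val = 2) :
    (csA n).simple i * (csA n).simple j = (csA n).simple j * (csA n).simple i := by
  have := (csA n).simple_mul_simple_pow i j
  rw [AMat_apply', h, pow_two] at this
  have h1 := eq_inv_of_mul_eq_one_left this
  simpa using h1

lemma A_braid {n : ℕ} {i j : Fin (n+1)} (h : aval i.val j.val = 3) :
    (csA n).simple i * (csA n).simple j * (csA n).simple i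
      = (csA n).simple j * (csA n).simple i * (csA n).simple j := by
  have := (csA n).simple_mul_simple_pow i j
  rw [AMat_apply', h] at this
  exact braid_of_pow3 (by simp) (by simp) this

def sg (n : ℕ) (i : ℕ) : WA n := if h : i < n+1 then (csA n).simple ⟨i, h⟩ else 1

lemma sg_of (n : ℕ) (i : Fin (n+1)) : sg n i.val = (csA n).simple i := by unfold sg; rw [dif_pos i.2]

lemma sg_sq (n i : ℕ) : sg n i * sg n i = 1 := by unfold sg; split_ifs <;> simp

lemma sg_comm (n : ℕ) {i j : ℕ} (h : i + 1 < j) : sg n i * sg n j = sg n j * sg n i := by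
  unfold sg; split_ifs <;> try simp
  exact A_comm (by rw [aval_two]; left; exact h)

lemma sg_braid (n : ℕ) {i : ℕ} (h : i + 1 < n+1) :
    sg n i * sg n (i+1) * sg n i = sg n (i+1) * sg n i * sg n (i+1) := by
  unfold sg; rw [dif_pos h, dif_pos (by omega)]
  exact A_braid (by simp [aval_three])

lemma pf_sg (n : ℕ) {i : ℕ} (h : i < n+1) : pf n (sg n i) = sw i := by
  unfold sg; rw [dif_pos h, pf_simple]

inductive HL (n r : ℕ) : ℕ → WA n → Prop
  | one (k : ℕ) : HL n r k 1
  | mul {k : ℕ} {w : WA n} {i : ℕ} : HL n r k w → i < r → HL n r (k+1) (w * sg n i)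

lemma HL.mono {n r k w} (h : HL n r k w) : ∀ {k'}, k ≤ k' → HL n r k' w := by
  induction h with
  | one k => intro k' _; exact HL.one k'
  | mul h hi ih =>
    intro k' hk
    obtain ⟨k'', rfl⟩ : ∃ k'', k' = k'' + 1 := ⟨k' - 1, by omega⟩
    exact HL.mul (ih (by omega)) hi

def Dn (n r : ℕ) : ℕ → WA n
  | 0 => 1
  | d+1 => Dn n r d * sg n (r - d)

lemma Dn_comm (n r : ℕ) {i : ℕ} : ∀ d, i + 1 + d < r + 1 → Dn n r d * sg n i = sg n i * Dn n r d
  | 0, _ => by simp [Dn]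
  | d+1, h => by
    rw [Dn, mul_assoc, ← sg_comm n (by omega), ← mul_assoc, Dn_comm n r d (by omega), mul_assoc]

lemma Dn_shift (n r : ℕ) {j : ℕ} (hr : r < n + 1) (hj : j + 1 ≤ r) : ∀ d, d ≤ r + 1 → r + 1 < j + 1 + d →
    Dn n r d * sg n (j+1) = sg n j * Dn n r d
  | 0, _, h => by omega
  | d+1, hd, h => by
    by_cases h1 : r + 1 < j + 1 + d
    · rw [Dn, mul_assoc, sg_comm n (by omega), ← mul_assoc, Dn_shift n r hr hj d (by omega) h1, mul_assoc]
    · obtain ⟨e, rfl⟩ : ∃ e, d = e + 1 := ⟨d - 1, by omega⟩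
      have e1 : r - e = j + 1 := by omega
      have e2 : r - (e+1) = j := by omega
      rw [Dn, Dn, e1, e2]
      calc Dn n r e * sg n (j+1) * sg n j * sg n (j+1)
          = Dn n r e * (sg n (j+1) * sg n j * sg n (j+1)) := by group
        _ = (Dn n r e * sg n j) * sg n (j+1) * sg n j := by rw [← sg_braid n (by omega)]; group
        _ = _ := by rw [Dn_comm n r e (by omega)]; group

lemma NF (n r : ℕ) (hr : r < n + 1) {k : ℕ} {w : WA n} (h : HL n (r+1) k w) :
    ∃ d k' w', d ≤ r + 1 ∧ k' + d ≤ k ∧ HL n r k' w' ∧ w = w' * Dn n r d := by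
  induction h with
  | one k => exact ⟨0, 0, 1, by omega, by omega, HL.one 0, by simp [Dn]⟩
  | @mul k w i h hi ih =>
    obtain ⟨d, k', w', hd, hk, hw', rfl⟩ := ih
    by_cases h1 : i + 1 + d < r + 1
    · exact ⟨d, k'+1, w' * sg n i, hd, by omega, hw'.mul (by omega), by
        rw [mul_assoc, Dn_comm n r d h1, mul_assoc]⟩
    by_cases h2 : i + 1 + d = r + 1
    · refine ⟨d+1, k', w', by omega, by omega, hw', ?_⟩
      rw [Dn, mul_assoc]; congr 3; omega
    by_cases h3 : i + d = r + 1
    · obtain ⟨e, rfl⟩ : ∃ e, d = e + 1 := ⟨d - 1, by omega⟩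
      refine ⟨e, k', w', by omega, by omega, hw', ?_⟩
      have : r - e = i := by omega
      rw [Dn, this, mul_assoc, mul_assoc, sg_sq, mul_one]
    · obtain ⟨j, rfl⟩ : ∃ j, i = j + 1 := ⟨i - 1, by omega⟩
      refine ⟨d, k'+1, w' * sg n j, hd, by omega, hw'.mul (by omega), ?_⟩
      rw [mul_assoc, Dn_shift n r hr (by omega) d hd (by omega), mul_assoc]

lemma HL.fix {n r k w} (hr : r ≤ n + 1) (h : HL n r k w) : ∀ {x}, r < x → pf n w x = x := by
  induction h with
  | one k => intro x _; simp
  | mul h hi ih =>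
    intro x hx
    rw [map_mul, Perm.mul_apply, pf_sg n (by omega), sw_apply, if_neg (by omega), if_neg (by omega)]
    exact ih hx

lemma Dn_perm (n r : ℕ) (hr : r < n + 1) : ∀ d, d ≤ r + 1 → ∀ x, pf n (Dn n r d) x =
    if x + d < r + 1 then x else if x + d = r + 1 then r + 1 else if x ≤ r + 1 then x - 1 else x
  | 0, _, x => by simp [Dn]; grind
  | d+1, hd, x => by
    rw [Dn, map_mul, Perm.mul_apply, pf_sg n (by omega), Dn_perm n r hr d (by omega), sw_apply]
    grind

lemma D1aux (n : ℕ) : ∀ r, r ≤ n + 1 → ∀ k w i, HL n r k w → i < r → pf n w (i+1) < pf n w i →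
    ∃ k', k' + 1 ≤ k ∧ HL n r k' (w * sg n i) := by
  intro r
  induction r with
  | zero => intro _ k w i _ hi; omega
  | succ r ih =>
    intro hr k w i h hi hd
    obtain ⟨d, k', w', hd', hk, hw', rfl⟩ := NF n r (by omega) h
    have hup : ∀ {k w}, HL n r k w → ∀ d, d ≤ r + 1 → HL n (r+1) (k+d) (w * Dn n r d) := by
      intro k w hw d
      have h0 : HL n (r+1) k w := by
        clear * - hw
        induction hw with
        | one k => exact HL.one k
        | mul h hi ih => exact ih.mul (by omega)
      induction d with
      | zero => intro _; simpa [Dn] using h0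
      | succ d ihd => intro hd; rw [Dn, ← mul_assoc]; exact (ihd (by omega)).mul (by omega)
    rw [map_mul, Perm.mul_apply, Perm.mul_apply, Dn_perm n r (by omega) d hd',
      Dn_perm n r (by omega) d hd'] at hd
    by_cases h1 : i + 1 + d < r + 1
    · rw [if_pos (by omega), if_pos (by omega)] at hd
      obtain ⟨k'', hk'', H⟩ := ih (by omega) k' w' i hw' (by omega) hd
      refine ⟨k'' + d, by omega, ?_⟩
      rw [mul_assoc, Dn_comm n r d h1, ← mul_assoc]
      exact hup H d hd'
    by_cases h2 : i + 1 + d = r + 1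
    · rw [if_neg (by omega), if_pos h2, hw'.fix (by omega) (by omega), if_pos (by omega)] at hd
      exfalso
      have h3 : pf n w' (pf n w' i) = pf n w' i := hw'.fix (by omega) (by omega)
      have := (pf n w').injective h3
      omega
    by_cases h3 : i + d = r + 1
    · obtain ⟨e, rfl⟩ : ∃ e, d = e + 1 := ⟨d - 1, by omega⟩
      refine ⟨k' + e, by omega, ?_⟩
      have : r - e = i := by omega
      rw [Dn, this, mul_assoc, mul_assoc, sg_sq, mul_one]
      exact hup hw' e (by omega)
    · obtain ⟨j, rfl⟩ : ∃ j, i = j + 1 := ⟨i - 1, by omega⟩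
      rw [if_neg (by omega), if_neg (by omega), if_pos (by omega), if_neg (by omega),
        if_neg (by omega), if_pos (by omega)] at hd
      obtain ⟨k'', hk'', H⟩ := ih (by omega) k' w' j hw' (by omega) hd
      refine ⟨k'' + d, by omega, ?_⟩
      rw [mul_assoc, Dn_shift n r (by omega) (by omega) d hd' (by omega), ← mul_assoc]
      exact hup H d hd'

lemma HL.len {n r k w} (hr : r ≤ n + 1) (h : HL n r k w) : (csA n).length w ≤ k := by
  induction h with
  | one k => simp
  | @mul k w i h hi ih =>
    have h1 := (csA n).length_mul_le w (sg n i)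
    have : sg n i = (csA n).simple ⟨i, by omega⟩ := by unfold sg; rw [dif_pos (by omega)]
    rw [this, (csA n).length_simple] at h1
    rw [this]; omega

lemma HL_word (n : ℕ) (l : List (Fin (n+1))) : HL n (n+1) l.length ((csA n).wordProd l) := by
  induction l using List.reverseRecOn with
  | nil => simpa using HL.one 0
  | append_singleton l i ih =>
    rw [(csA n).wordProd_append, (csA n).wordProd_singleton, ← sg_of, List.length_append]
    exact ih.mul i.2

lemma desc (n : ℕ) (w : WA n) (i : Fin (n+1)) (h : pf n w (i.val+1) < pf n w i.val) :
    (csA n).length (w * (csA n).simple i) + 1 = (csA n).length w := by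
  obtain ⟨l, hl, rfl⟩ := (csA n).exists_isReduced w
  obtain ⟨k', hk', H⟩ := D1aux n (n+1) le_rfl _ _ i.val (HL_word n l) i.2 h
  have := H.len le_rfl
  rw [sg_of] at this
  have h2 := (csA n).length_mul_simple ((csA n).wordProd l) i
  have h3 := hl.eq
  omega

lemma pf_mul_simple (n : ℕ) (w : WA n) (i : Fin (n+1)) (x : ℕ) :
    pf n (w * (csA n).simple i) x = pf n w (sw i.val x) := by
  rw [map_mul, pf_simple]; rfl

lemma pf_mul_simple' (n : ℕ) (w : WA n) (i : Fin (n+1)) (x : ℕ) :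
    (pf n (w * (csA n).simple i))⁻¹ x = sw i.val ((pf n w)⁻¹ x) := by
  rw [map_mul, pf_simple, mul_inv_rev]
  have : (sw i.val)⁻¹ = sw i.val := by simp [sw]
  rw [this]; rfl

lemma asc (n : ℕ) (w : WA n) (i : Fin (n+1)) (h : pf n w i.val < pf n w (i.val+1)) :
    (csA n).length (w * (csA n).simple i) = (csA n).length w + 1 := by
  have := desc n (w * (csA n).simple i) i (by
    rw [pf_mul_simple, pf_mul_simple]; simpa [sw_apply] using h)
  simp at this; omega

lemma desc_iff (n : ℕ) (w : WA n) (i : Fin (n+1)) : pf n w (i.val+1) < pf n w i.val ↔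
    (csA n).length (w * (csA n).simple i) < (csA n).length w := by
  constructor
  · intro h; have := desc n w i h; omega
  · intro h
    by_contra hc
    have : pf n w i.val ≠ pf n w (i.val+1) := fun h => by
      have := (pf n w).injective h; omega
    have := asc n w i (by omega)
    omega

lemma pf_inj (n : ℕ) : Function.Injective (pf n) := by
  rw [injective_iff_map_eq_one]
  intro w hw
  by_contra hc
  obtain ⟨i, hi⟩ := (csA n).exists_rightDescent_of_ne_one hc
  have := (desc_iff n w i).2 hi
  rw [hw] at this
  simp at this

end BCF
namespace BCF
open Equiv

abbrev CE (n : ℕ) : List (Fin (n+1)) → List (Fin (n+1)) → Prop := CommEquiv (AMat n)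

lemma CE.refl {n : ℕ} (l) : CE n l l := Relation.ReflTransGen.refl
lemma CE.trans {n : ℕ} {a b c} (h : CE n a b) (h' : CE n b c) : CE n a c :=
  Relation.ReflTransGen.trans h h'

lemma CE.symm {n : ℕ} {a b} (h : CE n a b) : CE n b a := by
  induction h with
  | refl => exact CE.refl _
  | tail _ h ih =>
    obtain ⟨u, v, i, j, hm, rfl, rfl⟩ := h
    refine CE.trans (Relation.ReflTransGen.single ⟨u, v, j, i, ?_, rfl, rfl⟩) ih
    rw [AMat_apply] at *; rwa [aval_symm]

lemma CE.swap {n : ℕ} (u v) {i j : Fin (n+1)} (h : aval i.val j.val = 2) :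
    CE n (u ++ i :: j :: v) (u ++ j :: i :: v) :=
  Relation.ReflTransGen.single ⟨u, v, i, j, h, rfl, rfl⟩

lemma CE.append {n : ℕ} {a b} (h : CE n a b) (c) : CE n (a ++ c) (b ++ c) := by
  induction h with
  | refl => exact CE.refl _
  | tail _ h ih =>
    obtain ⟨u, v, i, j, hm, rfl, rfl⟩ := h
    refine ih.trans ?_
    simpa using CE.swap u (v ++ c) hm

lemma CE.perm {n : ℕ} {a b} (h : CE n a b) : a.Perm b := by
  induction h with
  | refl => exact List.Perm.refl _
  | tail _ h ih =>
    obtain ⟨u, v, i, j, hm, rfl, rfl⟩ := h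
    exact ih.trans (List.Perm.append_left u (List.Perm.swap _ _ _))

lemma CE.prod {n : ℕ} {a b} (h : CE n a b) : (csA n).wordProd a = (csA n).wordProd b := by
  induction h with
  | refl => rfl
  | tail _ h ih =>
    obtain ⟨u, v, i, j, hm, rfl, rfl⟩ := h
    rw [ih]
    simp only [(csA n).wordProd_append, (csA n).wordProd_cons]
    rw [← mul_assoc ((csA n).simple i), A_comm hm, mul_assoc]

lemma CE.red {n : ℕ} {a b} (h : CE n a b) (ha : (csA n).IsReduced a) : (csA n).IsReduced b := by
  unfold CoxeterSystem.IsReduced at *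
  rw [← h.prod, ha, h.perm.length_eq]

def Good (n : ℕ) (m : List (Fin (n+1))) : Prop :=
  ∀ u v i j, aval i.val j.val = 3 → ¬ CE n m (u ++ i :: j :: i :: v)

lemma Good.ce {n : ℕ} {a b} (ha : Good n a) (h : CE n a b) : Good n b :=
  fun u v i j hij hc => ha u v i j hij (h.trans hc)

lemma Good.pre {n : ℕ} {a c} (ha : Good n (a ++ c)) : Good n a :=
  fun u v i j hij hc => ha u (v ++ c) i j hij (by simpa using hc.append c)

def dsc (n : ℕ) (w : WA n) (i : Fin (n+1)) : Prop := pf n w (i.val+1) < pf n w i.val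

lemma red_pre {n : ℕ} {a c} (h : (csA n).IsReduced (a ++ c)) : (csA n).IsReduced a := by
  simpa using h.take a.length

lemma wp_snoc (n : ℕ) (a) (i : Fin (n+1)) :
    (csA n).wordProd (a ++ [i]) = (csA n).wordProd a * (csA n).simple i := by
  rw [(csA n).wordProd_append, (csA n).wordProd_singleton]

lemma red_dsc {n : ℕ} {a} {i : Fin (n+1)} (h : (csA n).IsReduced (a ++ [i])) :
    dsc n ((csA n).wordProd (a ++ [i])) i := by
  have h2 := (red_pre h).eq
  have h1 := h.eq
  unfold dsc
  rw [desc_iff]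
  rw [wp_snoc] at *
  simp at *
  omega

lemma red_asc {n : ℕ} {a} {i : Fin (n+1)} (h : (csA n).IsReduced (a ++ [i])) :
    pf n ((csA n).wordProd a) i.val < pf n ((csA n).wordProd a) (i.val+1) := by
  have := red_dsc h
  unfold dsc at this
  rw [wp_snoc, pf_mul_simple, pf_mul_simple] at this
  simpa [sw_apply] using this

lemma red_of_dsc {n : ℕ} {w : WA n} {i : Fin (n+1)} {u} (h : dsc n w i) (hu : (csA n).IsReduced u)
    (hw : (csA n).wordProd u = w * (csA n).simple i) :
    (csA n).IsReduced (u ++ [i]) ∧ (csA n).wordProd (u ++ [i]) = w := by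
  have h1 : (csA n).wordProd (u ++ [i]) = w := by rw [wp_snoc, hw]; simp
  refine ⟨?_, h1⟩
  unfold CoxeterSystem.IsReduced at *
  rw [h1]
  have := desc n w i h
  rw [hw] at hu
  simp; omega

lemma mats (n : ℕ) : ∀ k m m', m.length = k → (csA n).IsReduced m → (csA n).IsReduced m' →
    (csA n).wordProd m = (csA n).wordProd m' → Good n m → CE n m m' := by
  intro k
  induction k with
  | zero =>
    intro m m' hk h h' he hg
    have := h.eq; have := h'.eq
    rw [he] at *
    have e1 : m = [] := List.length_eq_zero_iff.1 hk
    have e2 : m' = [] := List.length_eq_zero_iff.1 (by omega)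
    rw [e1, e2]; exact CE.refl _
  | succ k ih =>
    intro m m' hk h h' he hg
    have hl : m'.length = k + 1 := by rw [← hk, ← h.eq, ← h'.eq, he]
    obtain ⟨m1, i, rfl⟩ : ∃ m1 i, m = m1 ++ [i] := by
      have : m ≠ [] := by rintro rfl; simp at hk
      exact ⟨_, _, (List.dropLast_append_getLast this).symm⟩
    obtain ⟨m1', j, rfl⟩ : ∃ m1 i, m' = m1 ++ [i] := by
      have : m' ≠ [] := by rintro rfl; simp at hl
      exact ⟨_, _, (List.dropLast_append_getLast this).symm⟩
    have di := red_dsc h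
    have dj := red_dsc h'
    rw [← he] at dj
    obtain ⟨w, hw⟩ : ∃ w, w = (csA n).wordProd (m1 ++ [i]) := ⟨_, rfl⟩
    have ew1 : (csA n).wordProd m1 = w * (csA n).simple i := by rw [hw, wp_snoc]; simp
    have ew2 : (csA n).wordProd m1' = w * (csA n).simple j := by rw [hw, he, wp_snoc]; simp
    have hk1 : m1.length = k := by simpa using hk
    rw [← hw] at di dj
    by_cases hij : i = j
    · subst hij
      exact (ih m1 m1' hk1 (red_pre h) (red_pre h') (by rw [ew1, ew2]) hg.pre).append _
    have hij' : i.val ≠ j.val := fun hc => hij (Fin.ext hc)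
    by_cases h3 : aval i.val j.val = 3
    · exfalso
      have h3' := aval_three.1 h3
      have d1 : dsc n (w * (csA n).simple i) j := by
        unfold dsc at *; simp only [pf_mul_simple, sw_apply]
        grind
      have d2 : dsc n (w * (csA n).simple i * (csA n).simple j) i := by
        unfold dsc at *; simp only [pf_mul_simple, sw_apply]
        grind
      obtain ⟨u, hu, hue⟩ := (csA n).exists_isReduced
        (w * (csA n).simple i * (csA n).simple j * (csA n).simple i)
      obtain ⟨r1, p1⟩ := red_of_dsc d2 hu hue.symm
      obtain ⟨r2, p2⟩ := red_of_dsc d1 r1 p1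
      have := ih m1 _ hk1 (red_pre h) r2 (by rw [ew1, p2]) hg.pre
      exact hg u [] i j h3 (by simpa using this.append [i])
    · have h2 : aval i.val j.val = 2 := by
        unfold aval at *; split_ifs at * <;> simp_all
      have h2' := aval_two.1 h2
      have d1 : dsc n (w * (csA n).simple i) j := by
        unfold dsc at *; simp only [pf_mul_simple, sw_apply]
        grind
      have d2 : dsc n (w * (csA n).simple j) i := by
        unfold dsc at *; simp only [pf_mul_simple, sw_apply]
        grind
      obtain ⟨u, hu, hue⟩ := (csA n).exists_isReduced
        (w * (csA n).simple i * (csA n).simple j)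
      obtain ⟨r1, p1⟩ := red_of_dsc d1 hu hue.symm
      obtain ⟨r2, p2⟩ := red_of_dsc d2 hu (by rw [← hue, mul_assoc, A_comm h2, mul_assoc])
      have c1 := ih m1 _ hk1 (red_pre h) r1 (by rw [ew1, p1]) hg.pre
      have c2 : CE n (m1 ++ [i]) (u ++ [i] ++ [j]) := by
        refine (c1.append [i]).trans ?_
        have := (CE.swap u [] h2).symm
        simpa using this
      have hlen : (u ++ [i]).length = k := by
        have := c1.perm.length_eq; simp at *; omega
      have c3 := ih (u ++ [i]) m1' hlen r2 (red_pre h') (by rw [ew2, p2]) (hg.ce c2).pre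
      exact c2.trans (c3.append _)

lemma good_red (n : ℕ) (m) (hg : Good n m) (hs : ∀ u v i, ¬ CE n m (u ++ i :: i :: v)) :
    (csA n).IsReduced m := by
  induction m using List.reverseRecOn with
  | nil => simp [CoxeterSystem.IsReduced]
  | append_singleton m i ih =>
    have hr := ih hg.pre (fun u v j hc => hs u (v ++ [i]) j (by simpa using hc.append [i]))
    by_cases hd : dsc n ((csA n).wordProd m) i
    · exfalso
      obtain ⟨u, hu, hue⟩ := (csA n).exists_isReduced ((csA n).wordProd m * (csA n).simple i)
      obtain ⟨r1, p1⟩ := red_of_dsc hd hu hue.symm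
      have := mats n _ m _ rfl hr r1 p1.symm hg.pre
      exact hs u [] i (by simpa using this.append [i])
    · have hne : pf n ((csA n).wordProd m) i.val ≠ pf n ((csA n).wordProd m) (i.val+1) := fun h => by
        have := (pf n ((csA n).wordProd m)).injective h; omega
      unfold dsc at hd
      have := asc n ((csA n).wordProd m) i (by omega)
      unfold CoxeterSystem.IsReduced at *
      rw [wp_snoc, this, hr]; simp

lemma good_fc (n : ℕ) (m) (hg : Good n m) (hr : (csA n).IsReduced m) :
    IsFC (csA n) ((csA n).wordProd m) := by
  intro l l' hl e hl' e'
  have h1 := mats n _ m l rfl hr hl e.symm hg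
  have h2 := mats n _ m l' rfl hr hl' e'.symm hg
  exact h1.symm.trans h2

lemma fc_good (n : ℕ) (m) (hr : (csA n).IsReduced m) (hf : IsFC (csA n) ((csA n).wordProd m)) :
    Good n m := by
  intro u v i j h3 hc
  have hij : i ≠ j := by rintro rfl; simp [aval] at h3
  have e : (csA n).wordProd (u ++ i :: j :: i :: v) = (csA n).wordProd (u ++ j :: i :: j :: v) := by
    simp only [(csA n).wordProd_append, (csA n).wordProd_cons]
    have := A_braid h3
    simp only [← mul_assoc] at *
    rw [mul_assoc ((csA n).wordProd u), mul_assoc ((csA n).wordProd u), this]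
    simp only [← mul_assoc]
  have hr1 := hc.red hr
  have hr2 : (csA n).IsReduced (u ++ j :: i :: j :: v) := by
    unfold CoxeterSystem.IsReduced at *
    rw [← e, hr1]; simp
  have := hf _ _ hr1 hc.prod.symm hr2 (by rw [← e, hc.prod])
  have h5 := (CE.perm this).count_eq i
  simp [Ne.symm hij] at h5

lemma exists_desc (g : ℕ → ℕ) (a c : ℕ) (hac : a < c) (h : g c < g a) :
    ∃ d, a ≤ d ∧ d < c ∧ g (d+1) < g d := by
  by_contra! hc
  have : ∀ k, a + k ≤ c → g a ≤ g (a + k) := by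
    intro k
    induction k with
    | zero => intro _; exact le_rfl
    | succ k ih =>
      intro hk
      exact (ih (by omega)).trans (hc (a+k) (by omega) (by omega))
  have := this (c - a) (by omega)
  rw [show a + (c - a) = c by omega] at this
  omega

lemma pf_fix {n : ℕ} (w : WA n) {x : ℕ} (hx : n + 1 < x) : pf n w x = x := by
  obtain ⟨l, rfl⟩ := (csA n).wordProd_surjective w
  exact (HL_word n l).fix le_rfl hx

lemma desc_lt {n : ℕ} (w : WA n) {d : ℕ} (hd : pf n w (d+1) < pf n w d) : d < n + 1 := by
  by_contra hc
  have h1 := pf_fix w (x := d+1) (by omega)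
  have h2 := pf_fix w (x := pf n w d) (by omega)
  have := (pf n w).injective h2
  omega

lemma claimX {n : ℕ} {m : List (Fin (n+1))} {i d : Fin (n+1)} (hg : Good n (m ++ [i]))
    (hr : (csA n).IsReduced (m ++ [i])) (h3 : aval i.val d.val = 3)
    (d1 : dsc n ((csA n).wordProd m) d) (d2 : dsc n ((csA n).wordProd m * (csA n).simple d) i) :
    False := by
  obtain ⟨u, hu, hue⟩ := (csA n).exists_isReduced
    ((csA n).wordProd m * (csA n).simple d * (csA n).simple i)
  obtain ⟨r1, p1⟩ := red_of_dsc d2 hu hue.symm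
  obtain ⟨r2, p2⟩ := red_of_dsc d1 r1 p1
  have := mats n _ m _ rfl (red_pre hr) r2 p2.symm hg.pre
  exact hg u [] i d h3 (by simpa using this.append [i])

lemma claimY {n : ℕ} {m : List (Fin (n+1))} {i d : Fin (n+1)} (hg : Good n (m ++ [i]))
    (hr : (csA n).IsReduced (m ++ [i])) (h3 : aval d.val i.val = 2)
    (d1 : dsc n ((csA n).wordProd m) d) :
    ∃ u, u.length + 1 = m.length ∧ Good n (u ++ [i]) ∧ (csA n).IsReduced (u ++ [i]) ∧
      (csA n).wordProd u = (csA n).wordProd m * (csA n).simple d := by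
  obtain ⟨u, hu, hue⟩ := (csA n).exists_isReduced ((csA n).wordProd m * (csA n).simple d)
  obtain ⟨r1, p1⟩ := red_of_dsc d1 hu hue.symm
  have c := mats n _ m _ rfl (red_pre hr) r1 p1.symm hg.pre
  have c2 : CE n (m ++ [i]) (u ++ [i] ++ [d]) := by
    refine (c.append [i]).trans ?_
    simpa using CE.swap u [] h3
  refine ⟨u, ?_, (hg.ce c2).pre, red_pre (c2.red hr), hue.symm⟩
  have := c.perm.length_eq
  simp at this; omega

lemma claimA (n : ℕ) : ∀ (k : ℕ) (m : List (Fin (n+1))) (i : Fin (n+1)), m.length = k →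
    Good n (m ++ [i]) → (csA n).IsReduced (m ++ [i]) → ∀ c, i.val + 1 < c →
    pf n ((csA n).wordProd m) i.val < pf n ((csA n).wordProd m) c := by
  intro k
  induction k with
  | zero =>
    intro m i hk hg hr c hc
    rw [List.length_eq_zero_iff.1 hk]; simp; omega
  | succ k ih =>
    intro m i hk hg hr c hc
    have ha := red_asc hr
    set w := (csA n).wordProd m with hw
    by_contra hlt
    have hne : pf n w i.val ≠ pf n w c := fun h => by
      have := (pf n w).injective h; omega
    have hne2 : pf n w i.val ≠ pf n w (i.val + 2) := fun h => by
      have := (pf n w).injective h; omega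
    by_cases h2 : pf n w (i.val+2) < pf n w i.val
    · have h1 : pf n w (i.val + 1 + 1) < pf n w (i.val + 1) := lt_trans h2 ha
      have hd := desc_lt w h1
      refine claimX (d := ⟨i.val+1, hd⟩) hg hr (aval_three.2 (Or.inl rfl)) h1 ?_
      unfold dsc; simp only [pf_mul_simple, sw_apply]
      rw [← hw]; grind
    · have hc2 : i.val + 2 < c := by
        by_contra hh
        have : c = i.val + 2 := by omega
        rw [this] at hlt; omega
      obtain ⟨d, hd1, hd2, hd3⟩ := exists_desc (pf n w) (i.val+2) c hc2 (by omega)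
      have hd := desc_lt w hd3
      obtain ⟨u, hl, hg', hr', hp⟩ := claimY (d := ⟨d, hd⟩) hg hr
        (aval_two.2 (Or.inr (by simp; omega))) hd3
      have := ih u i (by omega) hg' hr' (sw d c) (by rw [sw_apply]; split_ifs <;> omega)
      rw [hp, ← hw] at this
      simp only [pf_mul_simple] at this
      have e1 : sw d (sw d c) = c := by
        have := congrArg (fun g : Perm ℕ => g c) (sw_sq d); simpa using this
      have e2 : sw d i.val = i.val := by rw [sw_apply, if_neg (by omega), if_neg (by omega)]
      rw [e1, e2] at this
      omega

lemma claimB (n : ℕ) : ∀ (k : ℕ) (m : List (Fin (n+1))) (i : Fin (n+1)), m.length = k →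
    Good n (m ++ [i]) → (csA n).IsReduced (m ++ [i]) → ∀ c, c < i.val →
    pf n ((csA n).wordProd m) c < pf n ((csA n).wordProd m) (i.val+1) := by
  intro k
  induction k with
  | zero =>
    intro m i hk hg hr c hc
    rw [List.length_eq_zero_iff.1 hk]; simp; omega
  | succ k ih =>
    intro m i hk hg hr c hc
    have ha := red_asc hr
    set w := (csA n).wordProd m with hw
    by_contra hlt
    obtain ⟨e, he⟩ : ∃ e, i.val = e + 1 := ⟨i.val - 1, by omega⟩
    have hne : pf n w c ≠ pf n w (i.val+1) := fun h => by
      have := (pf n w).injective h; omega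
    have hne2 : pf n w e ≠ pf n w (i.val + 1) := fun h => by
      have := (pf n w).injective h; omega
    by_cases h2 : pf n w (i.val+1) < pf n w e
    · have h1 : pf n w (e + 1) < pf n w e := by rw [← he]; omega
      have hd := desc_lt w h1
      refine claimX (d := ⟨e, hd⟩) hg hr (aval_three.2 (Or.inr he.symm)) h1 ?_
      unfold dsc; simp only [pf_mul_simple, sw_apply]
      rw [← hw]; grind
    · have hc2 : c < e := by
        by_contra hh
        have : c = e := by omega
        rw [this] at hlt; omega
      obtain ⟨d, hd1, hd2, hd3⟩ := exists_desc (pf n w) c e hc2 (by omega)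
      have hd := desc_lt w hd3
      obtain ⟨u, hl, hg', hr', hp⟩ := claimY (d := ⟨d, hd⟩) hg hr
        (aval_two.2 (Or.inl (by simp; omega))) hd3
      have := ih u i (by omega) hg' hr' (sw d c) (by rw [sw_apply]; split_ifs <;> omega)
      rw [hp, ← hw] at this
      simp only [pf_mul_simple] at this
      have e1 : sw d (sw d c) = c := by
        have := congrArg (fun g : Perm ℕ => g c) (sw_sq d); simpa using this
      have e2 : sw d (i.val+1) = i.val+1 := by rw [sw_apply, if_neg (by omega), if_neg (by omega)]
      rw [e1, e2] at this
      omega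

lemma bound_lo (g : Perm ℕ) (i : ℕ) (h : ∀ c, i < c → g i < g c) : g i ≤ i := by
  have := Finset.card_le_card_of_injOn (s := Finset.range (g i)) (t := Finset.range i) (g⁻¹ : Perm ℕ)
    (by
      intro v hv
      simp only [Finset.coe_range, Set.mem_Iio] at *
      by_contra hc
      have h1 : g (g⁻¹ v) = v := by simp
      rcases (not_lt.1 hc).eq_or_lt with h2 | h2
      · rw [← h2] at h1; omega
      · have := h _ h2; omega)
    (g⁻¹ : Perm ℕ).injective.injOn
  simpa using this

lemma bound_hi (g : Perm ℕ) (i : ℕ) (h : ∀ c, c < i → g c < g i) : i ≤ g i := by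
  have := Finset.card_le_card_of_injOn (s := Finset.range i) (t := Finset.range (g i)) g
    (by intro v hv; simp only [Finset.coe_range, Set.mem_Iio] at *; exact h _ hv)
    g.injective.injOn
  simpa using this

end BCF
namespace BCF
open Equiv

def upd (x : ℕ → Bool) (i : ℕ) (c : Bool) : ℕ → Bool := fun k => if k = i ∨ k = i + 1 then c else x k

lemma upd_apply (x : ℕ → Bool) (i : ℕ) (c : Bool) (k : ℕ) :
    upd x i c k = if k = i ∨ k = i + 1 then c else x k := rfl

lemma upd_upd (x i c d) : upd (upd x i c) i d = upd x i d := by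
  funext k; simp only [upd_apply]; grind

lemma upd_comm (x c d) {i j : ℕ} (h : i + 1 < j) : upd (upd x i c) j d = upd (upd x j d) i c := by
  funext k; simp only [upd_apply]; grind

abbrev VV : Type := (ℕ → Bool) → ℤ

def E2 : Type := Module.End ℤ VV

noncomputable instance : Ring E2 := inferInstanceAs (Ring (Module.End ℤ VV))

noncomputable instance E2alg : Algebra (Polynomial ℤ) E2 :=
  RingHom.toAlgebra' ((Int.castRingHom E2).comp (Polynomial.evalRingHom 2))
    (fun c x => by simp only [RingHom.comp_apply, eq_intCast]; exact (Int.cast_commute _ _))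

noncomputable def ee (i : ℕ) : E2 := show Module.End ℤ VV from
  { toFun := fun F x => if x i = x (i+1) then F (upd x i false) + F (upd x i true) else 0
    map_add' := by
      intro F G; funext x; simp only [Pi.add_apply]; split_ifs <;> ring
    map_smul' := by
      intro c F; funext x; simp only [Pi.smul_apply, smul_eq_mul, RingHom.id_apply]
      split_ifs <;> ring }

def app (a : E2) (F : VV) : VV := (show Module.End ℤ VV from a) F

lemma app_mul (a b : E2) (F) : app (a * b) F = app a (app b F) := rfl
lemma app_one (F) : app 1 F = F := rfl
lemma app_add (a b : E2) (F) : app (a + b) F = app a F + app b F := rfl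
lemma app_ee (i : ℕ) (F : VV) (x) : app (ee i) F x =
    if x i = x (i+1) then F (upd x i false) + F (upd x i true) else 0 := rfl
lemma E2ext {a b : E2} (h : ∀ F x, app a F x = app b F x) : a = b := by
  refine LinearMap.ext (fun F => funext (fun x => h F x))

lemma ee_sq (i : ℕ) : ee i * ee i = 2 * ee i := by
  rw [two_mul]
  apply E2ext; intro F x
  rw [app_mul, app_add, Pi.add_apply]
  simp only [app_ee, upd_upd]
  simp only [upd_apply]
  by_cases h : x i = x (i+1) <;> simp [h]

lemma ee_comm {i j : ℕ} (h : i + 1 < j) : ee i * ee j = ee j * ee i := by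
  apply E2ext; intro F x
  simp only [app_mul, app_ee, upd_comm x _ _ h]
  simp only [upd_apply]
  have h1 : ¬ (j = i ∨ j = i + 1) := by omega
  have h2 : ¬ (j + 1 = i ∨ j + 1 = i + 1) := by omega
  have h3 : ¬ (i = j ∨ i = j + 1) := by omega
  have h4 : ¬ (i + 1 = j ∨ i + 1 = j + 1) := by omega
  simp only [h1, h2, h3, h4, if_false]
  by_cases h : x i = x (i+1) <;> by_cases h' : x j = x (j+1) <;> simp [h, h'] <;> ring

lemma ee_braid (i : ℕ) : ee i * ee (i+1) * ee i = ee i := by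
  apply E2ext; intro F x
  simp only [app_mul, app_ee]
  by_cases h : x i = x (i+1)
  · rw [if_pos h, if_pos h]
    have key : ∀ c f, x (i+2) = c → upd (upd (upd x i c) (i+1) c) i f = upd x i f := by
      intro c f hc; funext k; simp only [upd_apply]; grind
    have h1 : ¬ (i + 1 + 1 = i ∨ i + 1 + 1 = i + 1) := by omega
    have h3 : ¬ (i = i + 1 ∨ i = i + 1 + 1) := by omega
    cases hx : x (i+2)
    · simp [upd_apply, hx, key _ _ hx, show ¬ (i = i+1+1) by omega, show ¬ (i+1+1 = i) by omega]
    · simp [upd_apply, hx, key _ _ hx, show ¬ (i = i+1+1) by omega, show ¬ (i+1+1 = i) by omega]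
  · simp [h]

lemma ee_braid' (i : ℕ) : ee (i+1) * ee i * ee (i+1) = ee (i+1) := by
  apply E2ext; intro F x
  simp only [app_mul, app_ee]
  by_cases h : x (i+1) = x (i+1+1)
  · rw [if_pos h, if_pos h]
    have key : ∀ c f, x i = c → upd (upd (upd x (i+1) c) i c) (i+1) f = upd x (i+1) f := by
      intro c f hc; funext k; simp only [upd_apply]; grind
    cases hx : x i
    · simp [upd_apply, hx, key _ _ hx, show ¬ (i = i+1+1) by omega, show ¬ (i+1+1 = i) by omega]
    · simp [upd_apply, hx, key _ _ hx, show ¬ (i = i+1+1) by omega, show ¬ (i+1+1 = i) by omega]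
  · simp [h]

lemma algMap_X : algebraMap (Polynomial ℤ) E2 Polynomial.X = 2 := by
  change ((Int.castRingHom E2).comp (Polynomial.evalRingHom 2)) Polynomial.X = 2
  simp

noncomputable def rep (n : ℕ) : TLA n →ₐ[Polynomial ℤ] E2 :=
  RingQuot.liftAlgHom (Polynomial ℤ)
    ⟨FreeAlgebra.lift (Polynomial ℤ) (fun i : Fin (n+1) => ee i.val), by
      intro x y h
      cases h with
      | sq i =>
        rw [Algebra.smul_def]
        simp only [map_mul, FreeAlgebra.lift_ι_apply, AlgHom.commutes, algMap_X]
        exact ee_sq _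
      | comm i j h =>
        simp only [map_mul, FreeAlgebra.lift_ι_apply]
        rcases aval_two.1 h with h | h
        · exact ee_comm h
        · exact (ee_comm h).symm
      | braid i j h =>
        simp only [map_mul, FreeAlgebra.lift_ι_apply]
        rcases aval_three.1 h with h | h
        · rw [← h]; exact ee_braid _
        · rw [← h]; exact ee_braid' _⟩

lemma rep_gen (n : ℕ) (i) : rep n (tlGen n i) = ee i.val := by
  unfold rep tlGen
  rw [RingQuot.liftAlgHom_mkAlgHom_apply]
  simp

lemma rep_δ (n : ℕ) : rep n (tlδ n) = 2 := by
  unfold tlδ; rw [AlgHom.commutes, algMap_X]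

lemma bProd_cons (n : ℕ) (i m) : bProd n (i :: m) = tlGen n i * bProd n m := by simp [bProd]
lemma bProd_append (n : ℕ) (l m) : bProd n (l ++ m) = bProd n l * bProd n m := by simp [bProd]

def Rl {n : ℕ} : List (Fin (n+1)) → (ℕ → Bool) → (ℕ → Bool) → Prop
  | [], x, y => x = y
  | i :: m, x, y => x i.val = x (i.val+1) ∧ ∃ c, Rl m (upd x i.val c) y

open Classical in
noncomputable def ind (y : ℕ → Bool) : VV := fun x => if x = y then 1 else 0

lemma app_pos (n : ℕ) (m : List (Fin (n+1))) (y) : ∀ x, 0 ≤ app (rep n (bProd n m)) (ind y) x ∧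
    (0 < app (rep n (bProd n m)) (ind y) x ↔ Rl m x y) := by
  induction m with
  | nil =>
    intro x
    simp only [bProd, List.map_nil, List.prod_nil, map_one, app_one, ind, Rl]
    split_ifs <;> simp_all
  | cons i m ih =>
    intro x
    rw [bProd_cons, map_mul, rep_gen, app_mul, app_ee, Rl]
    have h1 := ih (upd x i.val false)
    have h2 := ih (upd x i.val true)
    split_ifs with h
    · refine ⟨add_nonneg h1.1 h2.1, ?_⟩
      rw [Bool.exists_bool, ← h1.2, ← h2.2]
      have := h1.1; have := h2.1
      constructor
      · intro h'; refine ⟨h, ?_⟩; omega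
      · rintro ⟨_, h'⟩; omega
    · simp [h]

lemma app_two_pow (a : ℕ) (z : E2) (F x) : app (2 ^ a * z) F x = 2 ^ a * app z F x := by
  induction a generalizing z with
  | zero => simp
  | succ a ih =>
    rw [pow_succ, mul_assoc, ih, two_mul, app_add, Pi.add_apply, pow_succ]; ring

lemma Rl_const {n : ℕ} (m : List (Fin (n+1))) : Rl m (fun _ => false) (fun _ => false) := by
  induction m with
  | nil => rfl
  | cons i m ih =>
    refine ⟨rfl, false, ?_⟩
    have : upd (fun _ => false) i.val false = fun _ => false := by funext k; simp [upd]
    rwa [this]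

lemma eq_Rl {n a a' : ℕ} {m m' : List (Fin (n+1))}
    (h : tlδ n ^ a * bProd n m = tlδ n ^ a' * bProd n m') (x y) : Rl m x y ↔ Rl m' x y := by
  have h1 := congrArg (fun z => app (rep n z) (ind y) x) h
  simp only [map_mul, map_pow, rep_δ, app_two_pow] at h1
  rw [← (app_pos n m y x).2, ← (app_pos n m' y x).2]
  have p1 : (0:ℤ) < 2 ^ a := by positivity
  have p2 : (0:ℤ) < 2 ^ a' := by positivity
  rw [← mul_pos_iff_of_pos_left p1, h1, mul_pos_iff_of_pos_left p2]

lemma eq_a {n a a' : ℕ} {m : List (Fin (n+1))}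
    (h : tlδ n ^ a * bProd n m = tlδ n ^ a' * bProd n m) : a = a' := by
  have h1 := congrArg (fun z => app (rep n z) (ind (fun _ => false)) (fun _ => false)) h
  simp only [map_mul, map_pow, rep_δ, app_two_pow] at h1
  have h2 := (app_pos n m (fun _ => false) (fun _ => false)).2.2 (Rl_const m)
  have h3 := mul_right_cancel₀ h2.ne' h1
  exact pow_right_injective₀ (by norm_num) (by norm_num) h3

lemma Rl_append {n : ℕ} (l m : List (Fin (n+1))) : ∀ x y, Rl (l ++ m) x y ↔ ∃ z, Rl l x z ∧ Rl m z y := by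
  induction l with
  | nil => intro x y; simp [Rl]
  | cons i l ih =>
    intro x y
    simp only [List.cons_append, Rl, ih]
    constructor
    · rintro ⟨h, c, z, h1, h2⟩; exact ⟨z, ⟨h, c, h1⟩, h2⟩
    · rintro ⟨z, ⟨h, c, h1⟩, h2⟩; exact ⟨h, c, z, h1, h2⟩

lemma Rl_snoc {n : ℕ} (l : List (Fin (n+1))) (i x y) : Rl (l ++ [i]) x y ↔
    y i.val = y (i.val+1) ∧ ∃ c, Rl l x (upd y i.val c) := by
  rw [Rl_append]
  constructor
  · rintro ⟨z, h1, h2, c, rfl⟩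
    refine ⟨by simp [upd], z i.val, ?_⟩
    convert h1
    funext k; simp only [upd_apply]; grind
  · rintro ⟨h, c, h1⟩
    refine ⟨_, h1, by simp [upd], y i.val, ?_⟩
    change upd _ _ _ = y
    funext k; simp only [upd_apply]; grind

end BCF
namespace BCF
open Equiv

def ix : ℕ ⊕ ℕ → ℕ := Sum.elim id id
lemma ix_l (v) : ix (Sum.inl v) = v := rfl
lemma ix_r (v) : ix (Sum.inr v) = v := rfl

structure Dg (R : (ℕ → Bool) → (ℕ → Bool) → Prop) (w : Perm ℕ) (π : ℕ ⊕ ℕ → ℕ ⊕ ℕ) : Prop where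
  inv : ∀ p, π (π p) = p
  nfix : ∀ p, π p ≠ p
  rel : ∀ x y, R x y ↔ ∀ p, Sum.elim x y p = Sum.elim x y (π p)
  t1 : ∀ v, ix (π (Sum.inl v)) < v ↔ w⁻¹ v < v
  t2 : ∀ v, v < ix (π (Sum.inl v)) ↔ v < w⁻¹ v
  b1 : ∀ v, ix (π (Sum.inr v)) < v ↔ w v < v
  b2 : ∀ v, v < ix (π (Sum.inr v)) ↔ v < w v
  k1 : ∀ p q, p < q → p < w p → q < w q → w p < w q
  k2 : ∀ p q, p < q → ¬ p < w p → ¬ q < w q → w p < w q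

def npi (π : ℕ ⊕ ℕ → ℕ ⊕ ℕ) (i : ℕ) (p : ℕ ⊕ ℕ) : ℕ ⊕ ℕ :=
  if p = Sum.inr i then Sum.inr (i+1) else if p = Sum.inr (i+1) then Sum.inr i
  else if p = π (Sum.inr i) then π (Sum.inr (i+1))
  else if p = π (Sum.inr (i+1)) then π (Sum.inr i) else π p

lemma Dg.step {R w π} (h : Dg R w π) (i : ℕ) (hA : ∀ c, i + 1 < c → w i < w c)
    (hB : ∀ c, c < i → w c < w (i+1)) (hC : w i < w (i+1)) :
    Dg (fun x y => y i = y (i+1) ∧ ∃ c, R x (upd y i c)) (w * sw i) (npi π i) := by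
  have wi : w i ≤ i := bound_lo w i (fun c hc => by
    rcases Nat.lt_or_ge (i+1) c with h | h
    · exact hA c h
    · have : c = i + 1 := by omega
      subst this; exact hC)
  have wj : i + 1 ≤ w (i+1) := bound_hi w (i+1) (fun c hc => by
    rcases Nat.lt_or_ge c i with h | h
    · exact hB c h
    · have : c = i := by omega
      subst this; exact hC)
  have ha : ix (π (Sum.inr i)) ≤ i := by have := h.b2 i; omega
  have hb : i + 1 ≤ ix (π (Sum.inr (i+1))) := by have := h.b1 (i+1); omega
  have W : ∀ x, (w * sw i) x = w (sw i x) := fun x => rfl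
  have Wi : ∀ x, (w * sw i)⁻¹ x = sw i (w⁻¹ x) := by
    intro x; rw [mul_inv_rev, Perm.mul_apply]; congr 1
  have d1 : π (Sum.inr i) ≠ Sum.inr (i+1) := by intro e; rw [e, ix_r] at ha; omega
  have d2 : π (Sum.inr (i+1)) ≠ Sum.inr i := by intro e; rw [e, ix_r] at hb; omega
  have d3 : π (Sum.inr i) ≠ π (Sum.inr (i+1)) := by intro e; rw [e] at ha; omega
  have d4 : (Sum.inr i : ℕ ⊕ ℕ) ≠ Sum.inr (i+1) := by simp
  have i1 := h.inv (Sum.inr i)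
  have i2 := h.inv (Sum.inr (i+1))
  have f1 := h.nfix (Sum.inr i)
  have f2 := h.nfix (Sum.inr (i+1))
  have wg : ∀ v, w (w⁻¹ v) = v := fun v => by simp
  have gw : ∀ v, w⁻¹ (w v) = v := fun v => by simp
  have e0 : sw i i = i + 1 := by rw [sw_apply]; simp
  have e1 : sw i (i+1) = i := by rw [sw_apply]; simp
  have e2 : ∀ z, z ≠ i → z ≠ i+1 → sw i z = z := by intro z h1 h2; rw [sw_apply]; simp [h1, h2]
  have topk : ∀ v, (ix (npi π i (Sum.inl v)) < v ↔ sw i (w⁻¹ v) < v) ∧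
      (v < ix (npi π i (Sum.inl v)) ↔ v < sw i (w⁻¹ v)) := by
    intro v
    have q1 := h.t1 v
    have q2 := h.t2 v
    have r1 : Sum.inl v ≠ (Sum.inr i : ℕ ⊕ ℕ) := by simp
    have r2 : Sum.inl v ≠ (Sum.inr (i+1) : ℕ ⊕ ℕ) := by simp
    unfold npi
    rw [if_neg r1, if_neg r2]
    by_cases c1 : Sum.inl v = π (Sum.inr i)
    · rw [if_pos c1]
      rw [← c1, ix_l] at ha
      rw [← c1] at i1
      rw [i1, ix_r] at q1 q2
      by_cases z1 : w⁻¹ v = i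
      · rw [z1, e0]; omega
      by_cases z2 : w⁻¹ v = i + 1
      · rw [z2, e1]; rw [z2] at q1 q2; omega
      rw [e2 _ z1 z2]; omega
    rw [if_neg c1]
    by_cases c2 : Sum.inl v = π (Sum.inr (i+1))
    · rw [if_pos c2]
      rw [← c2, ix_l] at hb
      rw [← c2] at i2
      rw [i2, ix_r] at q1 q2
      by_cases z1 : w⁻¹ v = i
      · rw [z1, e0]; rw [z1] at q1 q2; omega
      by_cases z2 : w⁻¹ v = i + 1
      · rw [z2, e1]; omega
      rw [e2 _ z1 z2]; omega
    rw [if_neg c2]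
    by_cases z1 : w⁻¹ v = i
    · have z := wg v
      rw [z1] at z q1 q2
      have : v ≠ i := by
        rintro rfl
        have z3 : ix (π (Sum.inl v)) = v := by omega
        cases z4 : π (Sum.inl v) with
        | inl u => rw [z4, ix_l] at z3; subst z3; exact h.nfix _ z4
        | inr u => rw [z4, ix_r] at z3; subst z3; rw [← z4, h.inv] at c1; exact c1 rfl
      rw [z1, e0]; omega
    by_cases z2 : w⁻¹ v = i + 1
    · have z := wg v
      rw [z2] at z q1 q2
      have : v ≠ i + 1 := by
        rintro rfl
        have z3 : ix (π (Sum.inl (i+1))) = i + 1 := by omega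
        cases z4 : π (Sum.inl (i+1)) with
        | inl u => rw [z4, ix_l] at z3; subst z3; exact h.nfix _ z4
        | inr u => rw [z4, ix_r] at z3; subst z3; rw [← z4, h.inv] at c2; exact c2 rfl
      rw [z2, e1]; omega
    rw [e2 _ z1 z2]; exact ⟨q1, q2⟩
  have botk : ∀ v, (ix (npi π i (Sum.inr v)) < v ↔ w (sw i v) < v) ∧
      (v < ix (npi π i (Sum.inr v)) ↔ v < w (sw i v)) := by
    intro v
    unfold npi
    by_cases r1 : v = i
    · subst r1; rw [if_pos rfl, ix_r, e0]; omega
    rw [if_neg (by simpa using r1)]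
    by_cases r2 : v = i + 1
    · subst r2; rw [if_pos rfl, ix_r, e1]; omega
    rw [if_neg (by simpa using r2), e2 v r1 r2]
    have q1 := h.b1 v
    have q2 := h.b2 v
    by_cases c1 : Sum.inr v = π (Sum.inr i)
    · rw [if_pos c1]
      rw [← c1, ix_r] at ha
      rw [← c1] at i1
      rw [i1, ix_r] at q1 q2
      omega
    rw [if_neg c1]
    by_cases c2 : Sum.inr v = π (Sum.inr (i+1))
    · rw [if_pos c2]
      rw [← c2, ix_r] at hb
      rw [← c2] at i2
      rw [i2, ix_r] at q1 q2
      omega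
    rw [if_neg c2]; exact ⟨q1, q2⟩
  have key : ∀ p q, p < q → ((p < w (sw i p) → q < w (sw i q) → w (sw i p) < w (sw i q)) ∧
      (¬ p < w (sw i p) → ¬ q < w (sw i q) → w (sw i p) < w (sw i q))) := by
    intro p q hpq
    have K1 := h.k1
    have K2 := h.k2
    by_cases p1 : p = i
    · subst p1
      rw [e0]
      by_cases q2 : q = p + 1
      · subst q2; rw [e1]; omega
      rw [e2 q (by omega) q2]
      have := K1 (p+1) q (by omega)
      omega
    by_cases p2 : p = i + 1
    · subst p2
      rw [e1, e2 q (by omega) (by omega)]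
      have := hA q (by omega)
      omega
    rw [e2 p p1 p2]
    by_cases q1 : q = i
    · subst q1
      rw [e0]
      have := hB p hpq
      omega
    by_cases q2 : q = i + 1
    · subst q2
      rw [e1]
      have := K2 p i (by omega)
      omega
    rw [e2 q q1 q2]
    exact ⟨K1 p q hpq, K2 p q hpq⟩
  refine ⟨?_, ?_, ?_, ?_, ?_, ?_, ?_, ?_, ?_⟩
  · intro p
    have := h.inv p
    unfold npi
    grind
  · intro p
    have := h.nfix p
    unfold npi
    grind
  · intro x y
    have U : ∀ c p, p ≠ Sum.inr i → p ≠ Sum.inr (i+1) →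
        Sum.elim x (upd y i c) p = Sum.elim x y p := by
      intro c p h1 h2
      rcases p with p | p
      · rfl
      · simp only [Sum.elim_inr, upd_apply]
        rw [if_neg]
        rintro (rfl | rfl)
        · exact h1 rfl
        · exact h2 rfl
    have Ui : ∀ c, Sum.elim x (upd y i c) (Sum.inr i) = c := by intro c; simp [upd_apply]
    have Uj : ∀ c, Sum.elim x (upd y i c) (Sum.inr (i+1)) = c := by intro c; simp [upd_apply]
    have Yi : Sum.elim x y (Sum.inr i) = y i := rfl
    have Yj : Sum.elim x y (Sum.inr (i+1)) = y (i+1) := rfl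
    constructor
    · rintro ⟨hy, c, hc⟩ p
      rw [h.rel] at hc
      have g1 := hc (Sum.inr i)
      have g2 := hc (Sum.inr (i+1))
      rw [Ui, U c _ f1 d1] at g1
      rw [Uj, U c _ d2 f2] at g2
      have g3 := hc p
      unfold npi
      split_ifs with c1 c2 c3 c4
      · rw [c1, Yi, Yj, hy]
      · rw [c2, Yi, Yj, hy]
      · rw [c3, ← g1, ← g2]
      · rw [c4, ← g1, ← g2]
      · rwa [U c p c1 c2, U c (π p)] at g3
        · intro e; rw [← e, h.inv] at c3; exact c3 rfl
        · intro e; rw [← e, h.inv] at c4; exact c4 rfl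
    · intro hp
      have g0 := hp (Sum.inr i)
      have g1 := hp (π (Sum.inr i))
      have n0 : npi π i (Sum.inr i) = Sum.inr (i+1) := by simp [npi]
      have n1 : npi π i (π (Sum.inr i)) = π (Sum.inr (i+1)) := by simp [npi, f1, d1]
      rw [n0] at g0
      rw [n1] at g1
      refine ⟨g0, Sum.elim x y (π (Sum.inr i)), ?_⟩
      rw [h.rel]
      intro p
      by_cases c1 : p = Sum.inr i
      · rw [c1, Ui, U _ _ f1 d1]
      by_cases c2 : p = Sum.inr (i+1)
      · rw [c2, Uj, U _ _ d2 f2, g1]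
      rw [U _ p c1 c2]
      by_cases c3 : p = π (Sum.inr i)
      · rw [c3, i1, Ui]
      by_cases c4 : p = π (Sum.inr (i+1))
      · rw [c4, i2, Uj, g1]
      rw [U]
      · have := hp p
        unfold npi at this
        rwa [if_neg c1, if_neg c2, if_neg c3, if_neg c4] at this
      · intro e; rw [← e, h.inv] at c3; exact c3 rfl
      · intro e; rw [← e, h.inv] at c4; exact c4 rfl
  · intro v; rw [Wi]; exact (topk v).1
  · intro v; rw [Wi]; exact (topk v).2
  · intro v; exact (botk v).1
  · intro v; exact (botk v).2
  · intro p q hpq; exact (key p q hpq).1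
  · intro p q hpq; exact (key p q hpq).2

lemma Dg.nil {n : ℕ} : Dg (Rl (n := n) []) 1 Sum.swap := by
  refine ⟨?_, ?_, ?_, ?_, ?_, ?_, ?_, ?_, ?_⟩
  · simp
  · rintro (p | p) <;> simp
  · intro x y
    constructor
    · rintro rfl (p | p) <;> rfl
    · intro h; funext v; exact h (Sum.inl v)
  all_goals intros; simp [ix] at *
  all_goals assumption

lemma Dg.ex (n : ℕ) (m : List (Fin (n+1))) (hg : Good n m) (hr : (csA n).IsReduced m) :
    ∃ π, Dg (Rl m) (pf n ((csA n).wordProd m)) π := by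
  induction m using List.reverseRecOn with
  | nil => exact ⟨_, by simpa using Dg.nil⟩
  | append_singleton m i ih =>
    obtain ⟨π, h⟩ := ih hg.pre (red_pre hr)
    have h2 := h.step i.val (claimA n _ m i rfl hg hr) (claimB n _ m i rfl hg hr) (red_asc hr)
    refine ⟨npi π i.val, ?_⟩
    · convert h2 using 1
      · funext x y; exact propext (Rl_snoc m i x y)
      · rw [wp_snoc, map_mul, pf_simple]

lemma Dg.pi_eq {R w w' π π'} (h : Dg R w π) (h' : Dg R w' π') : π = π' := by
  funext p
  by_contra hc
  have hR : R (fun v => decide (Sum.inl v = p ∨ Sum.inl v = π p))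
      (fun v => decide (Sum.inr v = p ∨ Sum.inr v = π p)) := by
    rw [h.rel]
    have E : ∀ q, Sum.elim (fun v => decide (Sum.inl v = p ∨ Sum.inl v = π p))
      (fun v => decide (Sum.inr v = p ∨ Sum.inr v = π p)) q = decide (q = p ∨ q = π p) := by
      rintro (q | q) <;> rfl
    intro q
    rw [E, E]
    have := h.inv p
    have := h.inv q
    grind
  rw [h'.rel] at hR
  have E : ∀ q, Sum.elim (fun v => decide (Sum.inl v = p ∨ Sum.inl v = π p))
      (fun v => decide (Sum.inr v = p ∨ Sum.inr v = π p)) q = decide (q = p ∨ q = π p) := by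
    rintro (q | q) <;> rfl
  have := hR p
  rw [E, E] at this
  have := h'.nfix p
  grind

lemma Dg.w_eq_aux {R w w' π} (h : Dg R w π) (h' : Dg R w' π) (p : ℕ)
    (ih : ∀ q < p, w q = w' q) : ¬ w p < w' p := by
  intro hlt
  have hq : w' (w'⁻¹ (w p)) = w p := by simp
  set q := w'⁻¹ (w p) with hqd
  have a1 := h.t1 (w p)
  have a1' := h'.t1 (w p)
  have a2 := h.b2 p
  have a2' := h'.b2 p
  have e : w⁻¹ (w p) = p := by simp
  rw [e] at a1
  rw [← hqd] at a1'
  have hqp : q ≠ p := by rintro e; rw [e] at hq; omega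
  have hlt2 : q < p := by
    by_contra hge
    have hpq : p < q := by omega
    by_cases c : p < w p
    · have := h'.k1 p q hpq (by omega) (by omega)
      omega
    · have := h'.k2 p q hpq (by omega) (by omega)
      omega
  have := ih q hlt2
  rw [hq] at this
  exact hqp (w.injective this)

lemma Dg.w_eq {R w w' π} (h : Dg R w π) (h' : Dg R w' π) : w = w' := by
  ext p
  induction p using Nat.strong_induction_on with
  | _ p ih =>
    have h1 := h.w_eq_aux h' p ih
    have h2 := h'.w_eq_aux h p (fun q hq => (ih q hq).symm)
    omega

lemma tau_unique {n a a' : ℕ} {m m' : List (Fin (n+1))} (hg : Good n m) (hr : (csA n).IsReduced m)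
    (hg' : Good n m') (hr' : (csA n).IsReduced m')
    (h : tlδ n ^ a * bProd n m = tlδ n ^ a' * bProd n m') :
    (csA n).wordProd m = (csA n).wordProd m' := by
  obtain ⟨π, hd⟩ := Dg.ex n m hg hr
  obtain ⟨π', hd'⟩ := Dg.ex n m' hg' hr'
  have : Rl m = Rl m' := by funext x y; exact propext (eq_Rl h x y)
  rw [this] at hd
  obtain rfl := hd.pi_eq hd'
  exact pf_inj n (hd.w_eq hd')

lemma tl_sq (n : ℕ) (i) : tlGen n i * tlGen n i = tlδ n * tlGen n i := by
  have := RingQuot.mkAlgHom_rel (Polynomial ℤ) (TLRel.sq (n := n) i)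
  rw [map_mul, map_smul, Algebra.smul_def] at this
  exact this

lemma tl_comm (n : ℕ) (i j : Fin (n+1)) (h : aval i.val j.val = 2) :
    tlGen n i * tlGen n j = tlGen n j * tlGen n i := by
  have := RingQuot.mkAlgHom_rel (Polynomial ℤ) (TLRel.comm (n := n) i j h)
  rw [map_mul, map_mul] at this
  exact this

lemma tl_braid (n : ℕ) (i j : Fin (n+1)) (h : aval i.val j.val = 3) :
    tlGen n i * tlGen n j * tlGen n i = tlGen n i := by
  have := RingQuot.mkAlgHom_rel (Polynomial ℤ) (TLRel.braid (n := n) i j h)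
  rw [map_mul, map_mul] at this
  exact this

lemma b_swap (n : ℕ) (u v) (i j : Fin (n+1)) (h : aval i.val j.val = 2) :
    bProd n (u ++ i :: j :: v) = bProd n (u ++ j :: i :: v) := by
  simp only [bProd_append, bProd_cons]
  rw [← mul_assoc (tlGen n i), tl_comm n i j h, mul_assoc]

lemma b_ce {n : ℕ} {l m} (h : CE n l m) : bProd n l = bProd n m := by
  induction h with
  | refl => rfl
  | tail _ h ih =>
    obtain ⟨u, v, i, j, hm, rfl, rfl⟩ := h
    rw [ih]; exact b_swap n u v i j hm

lemma cval_aval {n a b : ℕ} (h : cval n a b = 2) : aval a b = 2 := by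
  unfold cval at h
  unfold aval
  split_ifs at h ⊢ <;> omega

lemma b_cc {n : ℕ} {l m} (h : CommEquiv (CMat n) l m) : bProd n l = bProd n m := by
  induction h with
  | refl => rfl
  | tail _ h ih =>
    obtain ⟨u, v, i, j, hm, rfl, rfl⟩ := h
    rw [ih]; exact b_swap n u v i j (cval_aval hm)

lemma delta_comm (n : ℕ) (x : TLA n) : x * tlδ n = tlδ n * x :=
  (Algebra.commutes Polynomial.X x).symm

lemma ex_min (n : ℕ) : ∀ (k : ℕ) (l : List (Fin (n+1))), l.length = k →
    ∃ a m, Good n m ∧ (csA n).IsReduced m ∧ bProd n l = tlδ n ^ a * bProd n m := by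
  intro k
  induction k using Nat.strong_induction_on with
  | _ k ih =>
    intro l hl
    by_cases hg : Good n l
    · by_cases hs : ∀ u v i, ¬ CE n l (u ++ i :: i :: v)
      · exact ⟨0, l, hg, good_red n l hg hs, by simp⟩
      · push Not at hs
        obtain ⟨u, v, i, hc⟩ := hs
        have hlen := hc.perm.length_eq
        simp at hlen
        obtain ⟨a, m, g, r, e⟩ := ih (u ++ i :: v).length (by simp; omega) _ rfl
        refine ⟨a + 1, m, g, r, ?_⟩
        rw [b_ce hc, pow_succ', mul_assoc, ← e]
        simp only [bProd_append, bProd_cons]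
        rw [← mul_assoc (tlGen n i), tl_sq, ← mul_assoc, ← mul_assoc, delta_comm]
        simp only [mul_assoc]
    · unfold Good at hg
      push Not at hg
      obtain ⟨u, v, i, j, h3, hc⟩ := hg
      have hlen := hc.perm.length_eq
      simp at hlen
      obtain ⟨a, m, g, r, e⟩ := ih (u ++ i :: v).length (by simp; omega) _ rfl
      refine ⟨a, m, g, r, ?_⟩
      rw [b_ce hc, ← e]
      simp only [bProd_append, bProd_cons]
      rw [← mul_assoc (tlGen n j), ← mul_assoc (tlGen n i), ← mul_assoc (tlGen n i),
        tl_braid n i j h3]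

end BCF

namespace BCF

/-- Let `n ≥ 2` and let `w̃` be a fully commutative element of the
Coxeter group of type `C̃ₙ`.  There exist a unique natural number `α(w̃)` and a unique
fully commutative element `τ(w̃)` of the Coxeter group of type `A_{n+1}` such that for
every reduced expression `s̃_{i₁} ⋯ s̃_{i_k}` of `w̃` and every reduced expression of
`τ(w̃)`, one has `b_{i₁} ⋯ b_{i_k} = δ^{α(w̃)} · b_{τ(w̃)}` in `TL(A_{n+1})`;
in particular `α(w̃)` and `τ(w̃)` do not depend on the chosen reduced expression. -/
theorem statement0 (n : ℕ) (hn : 2 ≤ n) (w : WC n) (hw : IsFC (csC n) w) :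
    ∃! p : ℕ × WA n,
      IsFC (csA n) p.2 ∧
      ∀ l : List (Fin (n + 1)), (csC n).IsReduced l → (csC n).wordProd l = w →
        ∀ m : List (Fin (n + 1)), (csA n).IsReduced m → (csA n).wordProd m = p.2 →
          bProd n l = tlδ n ^ p.1 * bProd n m := by
  obtain ⟨l0, hl0, hw0⟩ := (csC n).exists_isReduced w
  obtain ⟨a, m, hg, hr, e⟩ := ex_min n _ l0 rfl
  refine ⟨(a, (csA n).wordProd m), ⟨good_fc n m hg hr, ?_⟩, ?_⟩
  · intro l hl hlw m' hm' hmw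
    rw [b_cc (hw l l0 hl hlw hl0 hw0.symm), e, b_ce (mats n _ m m' rfl hr hm' hmw.symm hg)]
  · rintro ⟨a', t⟩ ⟨hf, h⟩
    obtain ⟨m', hm', rfl⟩ := (csA n).exists_isReduced t
    have e' := h l0 hl0 hw0.symm m' hm' rfl
    have hg' := fc_good n m' hm' hf
    have ee := e'.symm.trans e
    have hp := tau_unique hg' hm' hg hr ee
    rw [b_ce (mats n _ m' m rfl hm' hr hp hg')] at ee
    exact Prod.ext (eq_a ee) hp

end BCF
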